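/- arXiv:1510.04491 — 6 statements merged into one kernel-verified Lean document; each statement's English description precedes it below -/
import Mathlib

section
/- Let ψ be a flow on a metric space (X,d) and let h : X → ℝ be a Lipschitz continuous Lyapunov function for ψ. Then the neutral set N(h) contains the strongly chain recurrent set SCR(ψ). In particular, if ψ is strongly chain recurrent, then every Lipschitz continuous Lyapunov function for ψ is a first integral. -/
/-- A (continuous) flow on a metric space. -/
def IsFlow {X : Type*} [MetricSpace X] (ψ : ℝ → X → X) : Prop :=
  Continuous (fun p : ℝ × X => ψ p.1 p.2) ∧ (∀ x, ψ 0 x = x) ∧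
    ∀ t s x, ψ (t + s) x = ψ t (ψ s x)

/-- There is a strong `(ε,T)`-chain from `a` to `b`: a finite sequence
`(x_i, t_i)`, `i = 1, …, n` with `t_i ≥ T`, `x_1 = a`, `x_{n+1} = b`, and
`∑ d(ψ_{t_i}(x_i), x_{i+1}) < ε`. -/
def HasStrongChain {X : Type*} [MetricSpace X] (ψ : ℝ → X → X) (ε T : ℝ) (a b : X) : Prop :=
  ∃ (n : ℕ) (x : Fin (n + 1) → X) (t : Fin n → ℝ), 0 < n ∧ (∀ i, T ≤ t i) ∧
    x 0 = a ∧ x (Fin.last n) = b ∧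
    (∑ i : Fin n, dist (ψ (t i) (x i.castSucc)) (x i.succ)) < ε

/-- A strongly chain recurrent point. -/
def StronglyChainRecurrentPt {X : Type*} [MetricSpace X] (ψ : ℝ → X → X) (x : X) : Prop :=
  ∀ ε > 0, ∀ T ≥ (0 : ℝ), HasStrongChain ψ ε T x x

/-- A Lyapunov function for the flow `ψ`. -/
def IsLyapunov {X : Type*} [MetricSpace X] (ψ : ℝ → X → X) (h : X → ℝ) : Prop :=
  ∀ t ≥ (0 : ℝ), ∀ x, h (ψ t x) ≤ h x

/-- The neutral set of a Lyapunov function. -/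
def NeutralSet {X : Type*} [MetricSpace X] (ψ : ℝ → X → X) (h : X → ℝ) : Set X :=
  {x | ∀ t : ℝ, h (ψ t x) = h x}

/-- A first integral for the flow `ψ`. -/
def IsFirstIntegral {X : Type*} [MetricSpace X] (ψ : ℝ → X → X) (h : X → ℝ) : Prop :=
  ∀ (t : ℝ) (x : X), h (ψ t x) = h x

open Filter Topology in
/-- Backward continuation of a sequence of approximate preimages: if `h` is continuous and
nonincreasing along the flow and there are `y` with `ψ t y` close to `b`, `s ≤ t`, and `h y` at most
`c` up to a small error, then `h (ψ (-s) b) ≤ c`. -/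
theorem IsLyapunov.le_of_approx_preimages {X : Type*} [MetricSpace X] {ψ : ℝ → X → X} {h : X → ℝ}
    (hψ : IsFlow ψ) (hLyap : IsLyapunov ψ h) (hcont : Continuous h) {s c C : ℝ} {b : X}
    (H : ∀ ε > 0, ∃ (y : X) (t : ℝ), s ≤ t ∧ h y ≤ c + C * ε ∧ dist (ψ t y) b < ε) :
    h (ψ (-s) b) ≤ c := by
  obtain ⟨hψc, -, hadd⟩ := hψ
  choose y t ht hy hd using fun n : ℕ => H (1 / ((n : ℝ) + 1)) (by positivity)
  have hε := tendsto_one_div_add_atTop_nhds_zero_nat (𝕜 := ℝ)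
  have hlim : Tendsto (fun n => ψ (t n) (y n)) atTop (𝓝 b) :=
    tendsto_iff_dist_tendsto_zero.2
      (squeeze_zero (fun _ => dist_nonneg) (fun n => (hd n).le) hε)
  have hback : Continuous fun z => h (ψ (-s) z) :=
    hcont.comp (hψc.comp (continuous_const.prodMk continuous_id))
  have hupper : Tendsto (fun n : ℕ => c + C * (1 / ((n : ℝ) + 1))) atTop (𝓝 c) := by
    simpa using (hε.const_mul C).const_add c
  refine le_of_tendsto_of_tendsto' ((hback.tendsto b).comp hlim) hupper fun n => ?_
  calc h (ψ (-s) (ψ (t n) (y n))) = h (ψ (-s + t n) (y n)) := by rw [hadd]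
    _ ≤ h (y n) := hLyap _ (by linarith [ht n]) _
    _ ≤ _ := hy n

theorem LipschitzWith.le_add_coe_mul_dist {X : Type*} [MetricSpace X] {h : X → ℝ} {K : NNReal}
    (hK : LipschitzWith K h) (x y : X) : h y ≤ h x + K * dist x y := by
  rw [dist_comm]
  exact hK.le_add_mul y x

/-- Along a chain a Lipschitz Lyapunov function increases by at most the Lipschitz constant times
the total size of the jumps. -/
theorem IsLyapunov.le_add_mul_sum_dist {X : Type*} [MetricSpace X] {ψ : ℝ → X → X} {h : X → ℝ}
    (hLyap : IsLyapunov ψ h) {K : NNReal} (hK : LipschitzWith K h) {n : ℕ} (x : Fin (n + 1) → X)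
    (t : Fin n → ℝ) (ht : ∀ i, 0 ≤ t i) :
    h (x (Fin.last n)) ≤
      h (x 0) + K * ∑ i : Fin n, dist (ψ (t i) (x i.castSucc)) (x i.succ) := by
  induction n with
  | zero => simp
  | succ n ih =>
    have hinit := ih (fun i => x i.castSucc) (fun i => t i.castSucc) fun i => ht _
    have hjump := hK.le_add_coe_mul_dist (ψ (t (Fin.last n)) (x (Fin.last n).castSucc))
      (x (Fin.last n).succ)
    have hflow := hLyap _ (ht (Fin.last n)) (x (Fin.last n).castSucc)
    rw [Fin.sum_univ_castSucc, mul_add]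
    simp only [Fin.castSucc_zero, Fin.succ_last, Fin.succ_castSucc] at *
    linarith

theorem HasStrongChain.le_add_mul {X : Type*} [MetricSpace X] {ψ : ℝ → X → X} {h : X → ℝ}
    (hψ : IsFlow ψ) (hLyap : IsLyapunov ψ h) {K : NNReal} (hK : LipschitzWith K h) {ε T : ℝ}
    (hT : 0 ≤ T) {a b : X} (hc : HasStrongChain ψ ε T a b) : h b ≤ h (ψ T a) + K * ε := by
  obtain ⟨n, x, t, hn, ht, rfl, rfl, hsum⟩ := hc
  obtain ⟨n, rfl⟩ := Nat.exists_eq_succ_of_ne_zero hn.ne'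
  have htail := hLyap.le_add_mul_sum_dist hK (fun i => x i.succ) (fun i => t i.succ)
    fun i => hT.trans (ht _)
  have hjump := hK.le_add_coe_mul_dist (ψ (t 0) (x (Fin.castSucc 0))) (x (Fin.succ 0))
  have hflow : h (ψ (t 0) (x 0)) ≤ h (ψ T (x 0)) := by
    have := hLyap (t 0 - T) (sub_nonneg.2 (ht 0)) (ψ T (x 0))
    rwa [← hψ.2.2, sub_add_cancel] at this
  have hmul := mul_le_mul_of_nonneg_left hsum.le K.coe_nonneg
  rw [Fin.sum_univ_succ, mul_add] at hmul
  simp only [Fin.castSucc_zero, Fin.succ_last, Fin.succ_castSucc] at *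
  linarith

theorem HasStrongChain.exists_approx_preimage {X : Type*} [MetricSpace X] {ψ : ℝ → X → X}
    {h : X → ℝ} (hLyap : IsLyapunov ψ h) {K : NNReal} (hK : LipschitzWith K h) {ε T : ℝ}
    (hT : 0 ≤ T) {a b : X} (hc : HasStrongChain ψ ε T a b) :
    ∃ (y : X) (t : ℝ), T ≤ t ∧ h y ≤ h a + K * ε ∧ dist (ψ t y) b < ε := by
  obtain ⟨n, x, t, hn, ht, rfl, rfl, hsum⟩ := hc
  obtain ⟨n, rfl⟩ := Nat.exists_eq_succ_of_ne_zero hn.ne'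
  have hinit := hLyap.le_add_mul_sum_dist hK (fun i => x i.castSucc) (fun i => t i.castSucc)
    fun i => hT.trans (ht _)
  rw [Fin.sum_univ_castSucc] at hsum
  simp only [Fin.castSucc_zero, Fin.succ_last, Fin.succ_castSucc] at *
  have hnonneg : 0 ≤ ∑ i : Fin n, dist (ψ (t i.castSucc) (x i.castSucc.castSucc))
      (x i.succ.castSucc) := Finset.sum_nonneg fun _ _ => dist_nonneg
  have hlast := dist_nonneg (x := ψ (t (Fin.last n)) (x (Fin.last n).castSucc))
    (y := x (Fin.last (n + 1)))
  refine ⟨x (Fin.last n).castSucc, t (Fin.last n), ht _, hinit.trans ?_, by linarith⟩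
  gcongr
  linarith

theorem StronglyChainRecurrentPt.mem_neutralSet {X : Type*} [MetricSpace X] {ψ : ℝ → X → X}
    {h : X → ℝ} (hψ : IsFlow ψ) (hLyap : IsLyapunov ψ h) {K : NNReal} (hK : LipschitzWith K h)
    {x : X} (hx : StronglyChainRecurrentPt ψ x) : x ∈ NeutralSet ψ h := by
  intro t
  rcases le_total 0 t with ht | ht
  · refine le_antisymm (hLyap t ht x) (le_of_forall_pos_le_add fun δ hδ => ?_)
    have hK' : (0 : ℝ) < K + 1 := by positivity
    have hle := (hx (δ / (K + 1)) (by positivity) t ht).le_add_mul hψ hLyap hK ht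
    have hsmall : (K : ℝ) * (δ / (K + 1)) ≤ δ := by
      rw [mul_div_assoc', div_le_iff₀ hK']
      nlinarith
    linarith
  · apply le_antisymm
    · have hback := hLyap.le_of_approx_preimages hψ hK.continuous (s := -t) fun ε hε =>
        (hx ε hε (-t) (neg_nonneg.2 ht)).exists_approx_preimage hLyap hK (neg_nonneg.2 ht)
      rwa [neg_neg] at hback
    · have hflow := hLyap (-t) (neg_nonneg.2 ht) (ψ t x)
      rwa [← hψ.2.2, neg_add_cancel, hψ.2.1] at hflow

theorem neutral_set_contains_SCR {X : Type*} [MetricSpace X] (ψ : ℝ → X → X)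
    (hψ : IsFlow ψ) (h : X → ℝ) (hLip : ∃ K : NNReal, LipschitzWith K h)
    (hLyap : IsLyapunov ψ h) :
    {x | StronglyChainRecurrentPt ψ x} ⊆ NeutralSet ψ h ∧
      ((∀ x, StronglyChainRecurrentPt ψ x) → IsFirstIntegral ψ h) := by
  obtain ⟨K, hK⟩ := hLip
  exact ⟨fun x hx => hx.mem_neutralSet hψ hLyap hK,
    fun H t x => (H x).mem_neutralSet hψ hLyap hK t⟩
end

section
/- Let ψ be a flow on a metric space (X,d). If a point x ∈ X is not strongly chain recurrent, then there exists a continuous Lyapunov function h : X → ℝ for ψ such that x does not belong to the neutral set N(h). -/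
/-- `ψ_t` is Lipschitz for every `t ≥ 0`, uniformly for `t` in compact subsets
of `[0, +∞)`. -/
def UniformlyLipschitzTimeMaps {X : Type*} [MetricSpace X] (ψ : ℝ → X → X) : Prop :=
  ∀ T ≥ (0 : ℝ), ∃ C : NNReal, ∀ t ∈ Set.Icc 0 T, LipschitzWith C (ψ t)

/-- The flow `ψ` is strongly chain transitive. -/
def StronglyChainTransitive {X : Type*} [MetricSpace X] (ψ : ℝ → X → X) : Prop :=
  ∀ x y : X, ∀ ε > 0, ∀ T ≥ (0 : ℝ), HasStrongChain ψ ε T x y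

section StrongChains

variable {X : Type*} [MetricSpace X] {ψ : ℝ → X → X} {ε ε' T t : ℝ} {a b c : X}

namespace HasStrongChain

theorem pos (h : HasStrongChain ψ ε T a b) : 0 < ε := by
  obtain ⟨n, x, t, -, -, -, -, hsum⟩ := h
  exact (Finset.sum_nonneg fun _ _ => dist_nonneg).trans_lt hsum

theorem mono (h : HasStrongChain ψ ε T a b) (hε : ε ≤ ε') : HasStrongChain ψ ε' T a b := by
  obtain ⟨n, x, t, hn, ht, ha, hb, hsum⟩ := h
  exact ⟨n, x, t, hn, ht, ha, hb, hsum.trans_le hε⟩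

theorem single (ht : T ≤ t) (hε : dist (ψ t a) b < ε) : HasStrongChain ψ ε T a b :=
  ⟨1, ![a, b], fun _ => t, one_pos, fun _ => ht, rfl, rfl, by simpa using hε⟩

/-- Following the flow from the endpoint of a strong chain for a time at least `T` is free. -/
theorem flow_right (h : HasStrongChain ψ ε T a b) (ht : T ≤ t) :
    HasStrongChain ψ ε T a (ψ t b) := by
  obtain ⟨n, x, τ, hn, hτ, ha, hb, hsum⟩ := h
  refine ⟨n + 1, Fin.snoc x (ψ t b), Fin.snoc τ t, n.succ_pos, ?_, ?_, ?_, ?_⟩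
  · intro i
    induction i using Fin.lastCases with
    | last => simpa using ht
    | cast i => simpa using hτ i
  · rw [← Fin.castSucc_zero, Fin.snoc_castSucc, ha]
  · simp
  · rw [Fin.sum_univ_castSucc]
    simp only [Fin.snoc_castSucc, Fin.succ_castSucc, Fin.succ_last, Fin.snoc_last, hb, dist_self,
      add_zero]
    exact hsum

/-- Moving the endpoint of a strong chain costs at most the distance it is moved by. -/
theorem add_dist_right (h : HasStrongChain ψ ε T a b) (c : X) :
    HasStrongChain ψ (ε + dist b c) T a c := by
  obtain ⟨n, x, τ, hn, hτ, ha, hb, hsum⟩ := h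
  obtain ⟨m, rfl⟩ := Nat.exists_eq_succ_of_ne_zero hn.ne'
  refine ⟨m + 1, Fin.snoc (Fin.init x) c, τ, hn, hτ, ?_, ?_, ?_⟩
  · rw [← Fin.castSucc_zero, Fin.snoc_castSucc, ← ha]
    rfl
  · simp
  · rw [Fin.sum_univ_castSucc] at hsum ⊢
    simp only [Fin.snoc_castSucc, Fin.succ_castSucc, Fin.succ_last, Fin.snoc_last, Fin.init,
      Nat.succ_eq_add_one, hb] at hsum ⊢
    linarith [dist_triangle (ψ (τ (Fin.last m)) (x (Fin.last m).castSucc)) b c]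

end HasStrongChain

/-- The infimum of the costs of the strong chains from `a` to `b` with times at least `T`. -/
noncomputable def strongChainCost (ψ : ℝ → X → X) (T : ℝ) (a b : X) : ℝ :=
  sInf {ε | HasStrongChain ψ ε T a b}

theorem bddBelow_setOf_hasStrongChain : BddBelow {ε | HasStrongChain ψ ε T a b} :=
  ⟨0, fun _ h => h.pos.le⟩

theorem setOf_hasStrongChain_nonempty : {ε | HasStrongChain ψ ε T a b}.Nonempty :=
  ⟨_, .single le_rfl (lt_add_one _)⟩

theorem strongChainCost_le (h : HasStrongChain ψ ε T a b) : strongChainCost ψ T a b ≤ ε :=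
  csInf_le bddBelow_setOf_hasStrongChain h

theorem le_strongChainCost (h : ¬ HasStrongChain ψ ε T a b) : ε ≤ strongChainCost ψ T a b :=
  le_csInf setOf_hasStrongChain_nonempty fun _ h' =>
    le_of_not_ge fun hle => h (HasStrongChain.mono h' hle)

theorem strongChainCost_le_add_dist :
    strongChainCost ψ T a c ≤ strongChainCost ψ T a b + dist b c := by
  rw [← sub_le_iff_le_add]
  exact le_csInf setOf_hasStrongChain_nonempty fun _ h =>
    sub_le_iff_le_add.2 (strongChainCost_le (HasStrongChain.add_dist_right h c))

theorem continuous_strongChainCost : Continuous (strongChainCost ψ T a) :=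
  (LipschitzWith.of_le_add fun b c => by
    rw [dist_comm]; exact strongChainCost_le_add_dist).continuous

theorem strongChainCost_flow_le (ht : T ≤ t) :
    strongChainCost ψ T a (ψ t b) ≤ strongChainCost ψ T a b :=
  le_csInf setOf_hasStrongChain_nonempty fun _ h =>
    strongChainCost_le (HasStrongChain.flow_right h ht)

theorem strongChainCost_flow_self_nonpos (ht : T ≤ t) : strongChainCost ψ T a (ψ t a) ≤ 0 :=
  le_of_forall_pos_le_add fun _ hε => strongChainCost_le (.single ht (by simpa using hε))

/-- A continuous function that does not increase along the flow after times at least `T` is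
turned into a continuous Lyapunov function by taking its maximum along orbit segments. -/
theorem IsFlow.continuous_isLyapunov_sSup (hψ : IsFlow ψ) (hT : 0 ≤ T) {u : X → ℝ}
    (hu : Continuous u) (hdec : ∀ t ≥ T, ∀ y, u (ψ t y) ≤ u y) :
    Continuous (fun y => sSup ((fun s => u (ψ s y)) '' Set.Icc 0 T)) ∧
      IsLyapunov ψ (fun y => sSup ((fun s => u (ψ s y)) '' Set.Icc 0 T)) := by
  obtain ⟨hcont, hzero, hadd⟩ := hψ
  have hle : ∀ y, ∀ s ∈ Set.Icc 0 T, u (ψ s y) ≤ sSup ((fun s => u (ψ s y)) '' Set.Icc 0 T) :=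
    fun y s hs => le_csSup (isCompact_Icc.bddAbove_image
      (hu.comp (hcont.comp (.prodMk_left y))).continuousOn) (Set.mem_image_of_mem _ hs)
  refine ⟨isCompact_Icc.continuous_sSup (f := fun y s => u (ψ s y))
    (hu.comp (hcont.comp continuous_swap)), fun t ht y => ?_⟩
  refine csSup_le ((Set.nonempty_Icc.2 hT).image _) ?_
  rintro _ ⟨s, hs, rfl⟩
  simp only [← hadd]
  rcases le_total (s + t) T with h | h
  · exact hle y _ ⟨add_nonneg hs.1 ht, h⟩
  · calc u (ψ (s + t) y) ≤ u y := hdec _ h y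
      _ = u (ψ 0 y) := by rw [hzero]
      _ ≤ _ := hle y 0 ⟨le_rfl, hT⟩

end StrongChains

theorem exists_continuous_lyapunov_of_not_SCR {X : Type*} [MetricSpace X]
    (ψ : ℝ → X → X) (hψ : IsFlow ψ) (x : X)
    (hx : ¬ StronglyChainRecurrentPt ψ x) :
    ∃ h : X → ℝ, Continuous h ∧ IsLyapunov ψ h ∧ x ∉ NeutralSet ψ h := by
  simp only [StronglyChainRecurrentPt, not_forall] at hx
  obtain ⟨ε, hε, T, hT, hchain⟩ := hx
  have hu : Continuous (strongChainCost ψ T x) := continuous_strongChainCost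
  obtain ⟨hcont, hlyap⟩ :=
    hψ.continuous_isLyapunov_sSup hT hu fun t ht y => strongChainCost_flow_le ht
  refine ⟨_, hcont, hlyap, fun hneutral => ?_⟩
  have hlow : ε ≤ sSup ((fun s => strongChainCost ψ T x (ψ s x)) '' Set.Icc 0 T) := by
    refine (le_strongChainCost hchain).trans (le_csSup (isCompact_Icc.bddAbove_image
      (hu.comp (hψ.1.comp (.prodMk_left x))).continuousOn) ⟨0, ⟨le_rfl, hT⟩, ?_⟩)
    simp only [hψ.2.1]
  have hupp : sSup ((fun s => strongChainCost ψ T x (ψ s (ψ T x))) '' Set.Icc 0 T) ≤ 0 := by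
    refine csSup_le ((Set.nonempty_Icc.2 hT).image _) ?_
    rintro _ ⟨s, hs, rfl⟩
    simp only [← hψ.2.2]
    exact strongChainCost_flow_self_nonpos (le_add_of_nonneg_left hs.1)
  exact (hε.trans_le (hlow.trans ((hneutral T).symm.trans_le hupp))).false
end

section
/- Let ψ be a flow on a metric space (X,d). If ψ is strongly chain transitive, then every Lipschitz continuous Lyapunov function for ψ is constant. -/
/-- Along a chain, a Lipschitz Lyapunov function can only increase through the jumps. -/
theorem IsLyapunov.le_add_mul_of_hasStrongChain {X : Type*} [MetricSpace X]
    {ψ : ℝ → X → X} {h : X → ℝ} {K : NNReal} (hL : IsLyapunov ψ h) (hK : LipschitzWith K h)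
    {ε T : ℝ} (hT : 0 ≤ T) {a b : X} (hc : HasStrongChain ψ ε T a b) :
    h b ≤ h a + K * ε := by
  obtain ⟨n, x, t, -, ht, rfl, rfl, hsum⟩ := hc
  have htelescope : ∑ i : Fin n, (h (x i.succ) - h (x i.castSucc)) =
      h (x (Fin.last n)) - h (x 0) := by
    have hsucc := Fin.sum_univ_succ fun i => h (x i)
    rw [Fin.sum_univ_castSucc] at hsucc
    rw [Finset.sum_sub_distrib]
    linarith
  have hstep : ∑ i : Fin n, (h (x i.succ) - h (x i.castSucc)) ≤
      ∑ i : Fin n, K * dist (ψ (t i) (x i.castSucc)) (x i.succ) := by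
    refine Finset.sum_le_sum fun i _ => ?_
    have hdecr := hL (t i) (hT.trans (ht i)) (x i.castSucc)
    have hdist := hK.dist_le_mul (ψ (t i) (x i.castSucc)) (x i.succ)
    rw [Real.dist_eq] at hdist
    linarith [neg_abs_le (h (ψ (t i) (x i.castSucc)) - h (x i.succ))]
  rw [← Finset.mul_sum, htelescope] at hstep
  linarith [mul_le_mul_of_nonneg_left hsum.le K.coe_nonneg]

theorem lipschitz_lyapunov_constant_of_SCT {X : Type*} [MetricSpace X]
    (ψ : ℝ → X → X) (hψ : IsFlow ψ) (hSCT : StronglyChainTransitive ψ) :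
    ∀ h : X → ℝ, (∃ K : NNReal, LipschitzWith K h) → IsLyapunov ψ h →
      ∀ x y : X, h x = h y := by
  rintro h ⟨K, hK⟩ hL
  have hle : ∀ a b : X, h b ≤ h a := by
    intro a b
    refine le_of_forall_pos_le_add fun δ hδ => ?_
    have hK1 : (0 : ℝ) < K + 1 := by positivity
    have hchain := hL.le_add_mul_of_hasStrongChain hK le_rfl
      (hSCT a b (δ / (K + 1)) (div_pos hδ hK1) 0 le_rfl)
    have hbound : (K : ℝ) * (δ / (K + 1)) ≤ δ := by
      rw [← mul_div_assoc, div_le_iff₀ hK1]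
      linarith
    linarith
  exact fun x y => le_antisymm (hle y x) (hle x y)
end

section
/- Let E be a finite-dimensional real normed vector space endowed with its Lebesgue (Haar) measure, let V : E → E be a locally Lipschitz continuous vector field inducing a complete flow ψ : ℝ × E → E (i.e. for every x ∈ E, t ↦ ψ_t(x) is the solution of y' = V(y) with y(0) = x, defined for all t ∈ ℝ), and let h : E → ℝ be locally Lipschitz continuous. Then h is a Lyapunov function for ψ (i.e. h ∘ ψ_t ≤ h for all t ≥ 0) if and only if dh(x)[V(x)] ≤ 0 for almost every x ∈ E (h being differentiable almost everywhere by Rademacher's theorem). -/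
open MeasureTheory

variable {E : Type*} [NormedAddCommGroup E] [NormedSpace ℝ E] [FiniteDimensional ℝ E]
  [MeasurableSpace E] [BorelSpace E]

/-- `ψ` is the complete flow of the vector field `V`: for every `x`, the curve
`t ↦ ψ t x` solves `y' = V(y)` with `y(0) = x`, for all times `t ∈ ℝ`. -/
def IsCompleteFlowOf (V : E → E) (ψ : ℝ → E → E) : Prop :=
  (∀ x, ψ 0 x = x) ∧ ∀ (x : E) (t : ℝ), HasDerivAt (fun s => ψ s x) (V (ψ t x)) t

open Filter Topology Set Metric
open scoped NNReal

/-- A property true almost everywhere holds at almost every point of almost every line of a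
given direction. -/
theorem ae_ae_add_smul_of_ae (μ : Measure E) [μ.IsAddHaarMeasure] {p : E → Prop}
    (hp : ∀ᵐ y ∂μ, p y) (v : E) : ∀ᵐ y ∂μ, ∀ᵐ t : ℝ, p (y + t • v) := by
  set N : Set E := toMeasurable μ {y | ¬ p y}
  have hN : ∀ᵐ y ∂μ, y ∉ N := by
    rw [ae_iff]
    simpa only [not_not, ofPred_mem_eq, N, measure_toMeasurable] using ae_iff.1 hp
  have hmeas : MeasurableSet {q : ℝ × E | q.2 + q.1 • v ∉ N} := by
    have hm : Measurable fun q : ℝ × E => q.2 + q.1 • v := by fun_prop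
    exact hm (measurableSet_toMeasurable μ _).compl
  have key : ∀ᵐ t : ℝ, ∀ᵐ y ∂μ, y + t • v ∉ N :=
    Eventually.of_forall fun t => (eventually_add_right_iff μ (t • v)).2 hN
  filter_upwards [(Measure.ae_ae_comm hmeas).1 key] with y hy
  filter_upwards [hy] with t ht
  by_contra hcon
  exact ht (subset_toMeasurable μ _ hcon)

/-- An almost everywhere upper bound on a directional derivative of a Lipschitz function on a ball
bounds its increments from the center in that direction. -/
theorem LipschitzOnWith.sub_le_mul_of_ae_hasFDerivAt_le (μ : Measure E) [μ.IsAddHaarMeasure]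
    {h : E → ℝ} {K : ℝ≥0} {z v : E} {r c s : ℝ} (hh : LipschitzOnWith K h (ball z r))
    (hc : ∀ᵐ y ∂μ, y ∈ ball z r → ∀ f : E →L[ℝ] ℝ, HasFDerivAt h f y → f v ≤ c)
    (hs : 0 ≤ s) (hr : 0 < r) (hzs : z + s • v ∈ ball z r) :
    h (z + s • v) - h z ≤ c * s := by
  have hae : ∀ᵐ y ∂μ, y ∈ ball z r → ∃ f : E →L[ℝ] ℝ, HasFDerivAt h f y ∧ f v ≤ c := by
    filter_upwards [hc, hh.ae_differentiableWithinAt_of_mem (μ := μ)] with y hy hd hyr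
    have hdy := ((hd hyr).differentiableAt (isOpen_ball.mem_nhds hyr)).hasFDerivAt
    exact ⟨_, hdy, hy hyr _ hdy⟩
  have hline : ∀ᵐ y ∂μ, y ∈ ball z r → y + s • v ∈ ball z r →
      h (y + s • v) - h y ≤ c * s := by
    filter_upwards [ae_ae_add_smul_of_ae μ hae v] with y hy hy0 hys
    have hseg : ∀ t ∈ Icc 0 s, y + t • v ∈ ball z r := by
      intro t ht
      have hconv := (convex_ball z r).affine_preimage (AffineMap.lineMap y (y + v) : ℝ →ᵃ[ℝ] E)
      have hmem : ∀ τ : ℝ, τ ∈ AffineMap.lineMap y (y + v) ⁻¹' ball z r ↔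
          y + τ • v ∈ ball z r := fun τ => by
        rw [mem_preimage, AffineMap.lineMap_apply, vsub_eq_sub, add_sub_cancel_left, vadd_eq_add,
          add_comm]
      exact (hmem t).1 (hconv.ordConnected.out ((hmem 0).2 (by simpa using hy0))
        ((hmem s).2 hys) ht)
    have hlip : LipschitzOnWith (K * ‖v‖₊) (fun t : ℝ => h (y + t • v)) (uIcc 0 s) := by
      rw [uIcc_of_le hs]
      refine hh.comp (LipschitzWith.lipschitzOnWith (LipschitzWith.of_dist_le_mul ?_)) hseg
      intro a b
      rw [dist_add_left, dist_eq_norm, ← sub_smul, norm_smul, dist_eq_norm, mul_comm, coe_nnnorm]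
    have hac := hlip.absolutelyContinuousOnInterval
    have hint := hac.integral_deriv_eq_sub
    have hle : ∫ t in (0 : ℝ)..s, deriv (fun t : ℝ => h (y + t • v)) t ≤ ∫ _t in (0 : ℝ)..s, c := by
      refine intervalIntegral.integral_mono_ae_restrict hs hac.intervalIntegrable_deriv
        intervalIntegrable_const ?_
      rw [EventuallyLE, ae_restrict_iff' measurableSet_Icc]
      filter_upwards [hy] with t ht hts
      obtain ⟨f, hf, hfc⟩ := ht (hseg t hts)
      have hd : HasDerivAt (fun t : ℝ => y + t • v) v t := by
        simpa using ((hasDerivAt_id t).smul_const v).const_add y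
      exact (hf.comp_hasDerivAt t hd).deriv.trans_le hfc
    rw [hint] at hle
    simpa [mul_comm] using hle
  by_contra! hcon
  have hzr : z ∈ ball z r := mem_ball_self hr
  have hcont : ContinuousAt (fun y => h (y + s • v) - h y) z := by
    refine ContinuousAt.sub ?_ (hh.continuousOn.continuousAt (isOpen_ball.mem_nhds hzr))
    exact ContinuousAt.comp (f := fun y => y + s • v)
      (hh.continuousOn.continuousAt (isOpen_ball.mem_nhds hzs)) (by fun_prop)
  have hmem : ∀ᶠ y in 𝓝 z, y + s • v ∈ ball z r :=
    (continuous_id.add continuous_const).continuousAt.eventually (isOpen_ball.mem_nhds hzs)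
  have hball : ∀ᶠ y in 𝓝 z, y ∈ ball z r := isOpen_ball.mem_nhds hzr
  have hev := (hcont.eventually (lt_mem_nhds hcon)).and (hball.and hmem)
  obtain ⟨y, hy, h1, h2, h3⟩ :=
    ((mem_closure_iff_frequently.1 (Measure.dense_of_ae hline z)).and_eventually hev).exists
  exact absurd (hy h2 h3) (not_le.2 h1)

/-- If `dh(V) ≤ 0` almost everywhere, the increments of a locally Lipschitz `h` along `V` are
infinitesimally nonpositive at every point. -/
theorem LocallyLipschitz.eventually_sub_le_of_ae_hasFDerivAt_nonpos (μ : Measure E)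
    [μ.IsAddHaarMeasure] {V : E → E} (hV : Continuous V) {h : E → ℝ} (hh : LocallyLipschitz h)
    (hae : ∀ᵐ x ∂μ, ∀ f : E →L[ℝ] ℝ, HasFDerivAt h f x → f (V x) ≤ 0) (z : E)
    {ε : ℝ} (hε : 0 < ε) :
    ∀ᶠ s in 𝓝[>] (0 : ℝ), h (z + s • V z) - h z ≤ ε * s := by
  obtain ⟨K, U, hU, hK⟩ := hh z
  have hδ : 0 < ε / (K + 1) := by positivity
  have hVz : ∀ᶠ y in 𝓝 z, ‖V z - V y‖ < ε / (K + 1) := by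
    have := hV.continuousAt.eventually (ball_mem_nhds (V z) hδ)
    filter_upwards [this] with y hy
    rwa [dist_comm, dist_eq_norm] at hy
  obtain ⟨r, hr, hball⟩ := Metric.mem_nhds_iff.1 (inter_mem hU hVz)
  have hKr : LipschitzOnWith K h (ball z r) := hK.mono fun y hy => (hball hy).1
  have hc : ∀ᵐ y ∂μ, y ∈ ball z r → ∀ f : E →L[ℝ] ℝ, HasFDerivAt h f y → f (V z) ≤ ε := by
    filter_upwards [hae] with y hy hyr f hf
    have hnorm : ‖f‖ ≤ K := hf.le_of_lipschitzOn (isOpen_ball.mem_nhds hyr) hKr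
    have hdiff : ‖V z - V y‖ ≤ ε / (K + 1) := (hball hyr).2.le
    have hle : f (V z - V y) ≤ K * (ε / (K + 1)) :=
      (le_abs_self _).trans (f.le_of_opNorm_le_of_le hnorm hdiff)
    have hKε : K * (ε / (K + 1)) ≤ ε := by
      rw [mul_div_assoc', div_le_iff₀ (by positivity)]
      nlinarith
    rw [map_sub] at hle
    linarith [hy f hf]
  have hmem : ∀ᶠ s in 𝓝[>] (0 : ℝ), z + s • V z ∈ ball z r := by
    have hcont : Continuous fun s : ℝ => z + s • V z := by fun_prop
    have h0 : z + (0 : ℝ) • V z ∈ ball z r := by simpa using hr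
    exact nhdsWithin_le_nhds (hcont.continuousAt.eventually (isOpen_ball.mem_nhds h0))
  filter_upwards [hmem, self_mem_nhdsWithin] with s hs hs0
  exact hKr.sub_le_mul_of_ae_hasFDerivAt_le μ hc (le_of_lt hs0) hr hs

/-- Along a differentiable curve, the increments of a locally Lipschitz function are, to first
order, at most its increments along the tangent. -/
theorem LocallyLipschitz.eventually_comp_sub_le {F : Type*} [NormedAddCommGroup F]
    [NormedSpace ℝ F] {h : F → ℝ} (hh : LocallyLipschitz h) {γ : ℝ → F} {v : F} {t : ℝ}
    (hγ : HasDerivAt γ v t) {ε : ℝ} (hε : 0 < ε) :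
    ∀ᶠ u in 𝓝[>] t, h (γ u) ≤ h (γ t + (u - t) • v) + ε * (u - t) := by
  obtain ⟨K, U, hU, hK⟩ := hh (γ t)
  have hδ : 0 < ε / (K + 1) := by positivity
  have hsmall := hγ.isLittleO.def hδ
  have htan : ∀ᶠ u in 𝓝 t, γ t + (u - t) • v ∈ U := by
    have hcont : Continuous fun u : ℝ => γ t + (u - t) • v := by fun_prop
    refine (hcont.tendsto t).eventually ?_
    simpa using hU
  filter_upwards [nhdsWithin_le_nhds hsmall, nhdsWithin_le_nhds htan,
    nhdsWithin_le_nhds (hγ.continuousAt.eventually hU), self_mem_nhdsWithin] with u h1 h2 h3 h4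
  have hu : 0 < u - t := sub_pos.2 h4
  have hd := hK.dist_le_mul _ h3 _ h2
  rw [Real.dist_eq, dist_eq_norm, ← sub_sub] at hd
  rw [Real.norm_of_nonneg hu.le] at h1
  have hKε : K * (ε / (K + 1) * (u - t)) ≤ ε * (u - t) := by
    rw [← mul_assoc]
    refine mul_le_mul_of_nonneg_right ?_ hu.le
    rw [mul_div_assoc', div_le_iff₀ (by positivity)]
    nlinarith
  linarith [le_abs_self (h (γ u) - h (γ t + (u - t) • v)),
    mul_le_mul_of_nonneg_left h1 K.coe_nonneg]

theorem lyapunov_iff_deriv_nonpos_ae (μ : Measure E) [μ.IsAddHaarMeasure]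
    (V : E → E) (hV : LocallyLipschitz V) (ψ : ℝ → E → E)
    (hψ : IsCompleteFlowOf V ψ) (h : E → ℝ) (hh : LocallyLipschitz h) :
    (∀ t ≥ (0 : ℝ), ∀ x, h (ψ t x) ≤ h x) ↔
      ∀ᵐ x ∂μ, ∀ f : E →L[ℝ] ℝ, HasFDerivAt h f x → f (V x) ≤ 0 := by
  obtain ⟨hψ0, hψd⟩ := hψ
  constructor
  · intro hL
    refine Eventually.of_forall fun x f hf => ?_
    have hcurve := hψd x 0
    rw [hψ0] at hcurve
    have hd : HasDerivAt (fun t => h (ψ t x)) (f (V x)) 0 :=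
      HasFDerivAt.comp_hasDerivAt (f := fun s => ψ s x) 0 (by simpa only [hψ0] using hf) hcurve
    have hslope := hd.tendsto_slope.mono_left
      (nhdsWithin_mono 0 fun t (ht : t ∈ Ioi (0 : ℝ)) => ne_of_gt ht)
    refine le_of_tendsto hslope ?_
    filter_upwards [self_mem_nhdsWithin] with t ht
    rw [slope_def_field, hψ0, sub_zero]
    exact div_nonpos_of_nonpos_of_nonneg (sub_nonpos.2 (hL t (le_of_lt ht) x)) (le_of_lt ht)
  · intro hae T hT x
    have hcont : Continuous fun t => h (ψ t x) :=
      hh.continuous.comp (continuous_iff_continuousAt.2 fun t => (hψd x t).continuousAt)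
    refine image_le_of_liminf_slope_right_le_deriv_boundary (f := fun t => h (ψ t x))
      (a := 0) (b := T) (B := fun _ => h x) (B' := fun _ => 0) hcont.continuousOn
      (by simp [hψ0]) continuousOn_const (fun t _ => hasDerivWithinAt_const t _ _) ?_
      (right_mem_Icc.2 hT)
    intro t _ r hr
    have hr3 : 0 < r / 3 := by positivity
    have htan := hh.eventually_sub_le_of_ae_hasFDerivAt_nonpos μ hV.continuous hae (ψ t x) hr3
    have hshift : Tendsto (fun u : ℝ => u - t) (𝓝[>] t) (𝓝[>] 0) := by
      refine tendsto_nhdsWithin_of_tendsto_nhds_of_eventually_within _ ?_ ?_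
      · have hc : Continuous fun u : ℝ => u - t := by fun_prop
        simpa using (hc.tendsto t).mono_left nhdsWithin_le_nhds
      · filter_upwards [self_mem_nhdsWithin] with u hu
        exact mem_Ioi.2 (sub_pos.2 (mem_Ioi.1 hu))
    refine Eventually.frequently ?_
    filter_upwards [hshift.eventually htan, hh.eventually_comp_sub_le (hψd x t) hr3,
      self_mem_nhdsWithin] with u h1 h2 hu
    have hu' : 0 < u - t := sub_pos.2 hu
    rw [slope_def_field, div_lt_iff₀ hu']
    nlinarith [mul_pos hr hu']
end

section
/- Let E be a finite-dimensional real normed vector space endowed with its Lebesgue (Haar) measure, let V : E → E be a locally Lipschitz continuous vector field inducing a complete flow ψ : ℝ × E → E, and let h : E → ℝ be locally Lipschitz continuous. Then h is a first integral for ψ (i.e. h ∘ ψ_t = h for all t ∈ ℝ) if and only if dh(x)[V(x)] = 0 for almost every x ∈ E. -/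
open MeasureTheory

variable {E : Type*} [NormedAddCommGroup E] [NormedSpace ℝ E] [FiniteDimensional ℝ E]
  [MeasurableSpace E] [BorelSpace E]

open Set Metric

section Flow

variable {F : Type*} [NormedAddCommGroup F] [NormedSpace ℝ F] [FiniteDimensional ℝ F]
  {V : F → F}

omit [NormedSpace ℝ F] [FiniteDimensional ℝ F] in
/-- A locally Lipschitz function is Lipschitz on every bounded set. -/
theorem LocallyLipschitz.exists_lipschitzOnWith_of_isBounded [ProperSpace F]
    {G : Type*} [PseudoMetricSpace G] {f : F → G} (hf : LocallyLipschitz f) {s : Set F}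
    (hs : Bornology.IsBounded s) : ∃ K, LipschitzOnWith K f s := by
  obtain ⟨K, hK⟩ := LocallyLipschitzOn.exists_lipschitzOnWith_of_compact
    hs.isCompact_closure (hf.locallyLipschitzOn (s := closure s))
  exact ⟨K, hK.mono subset_closure⟩

/-- Two solutions of the autonomous ODE `y' = V y` with the same initial value agree at all
times. -/
theorem LocallyLipschitz.eq_of_hasDerivAt (hV : LocallyLipschitz V) {f g : ℝ → F}
    (hf : ∀ t, HasDerivAt f (V (f t)) t) (hg : ∀ t, HasDerivAt g (V (g t)) t)
    (h0 : f 0 = g 0) : f = g := by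
  have : ProperSpace F := FiniteDimensional.proper_real F
  ext t
  have hfc : Continuous f := continuous_iff_continuousAt.2 fun t => (hf t).continuousAt
  have hgc : Continuous g := continuous_iff_continuousAt.2 fun t => (hg t).continuousAt
  set T := |t| + 1
  have hbdd : Bornology.IsBounded (f '' Icc (-T) T ∪ g '' Icc (-T) T) :=
    ((isCompact_Icc.image hfc).union (isCompact_Icc.image hgc)).isBounded
  obtain ⟨K, hK⟩ := hV.exists_lipschitzOnWith_of_isBounded hbdd
  refine ODE_solution_unique_of_mem_Icc (v := fun _ => V) (K := K) (a := -T) (b := T) (t₀ := 0)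
    (s := fun _ => f '' Icc (-T) T ∪ g '' Icc (-T) T) (fun _ _ => hK) ?_ hfc.continuousOn
    (fun t _ => hf t) (fun t ht => .inl (mem_image_of_mem f (Ioo_subset_Icc_self ht)))
    hgc.continuousOn (fun t _ => hg t)
    (fun t ht => .inr (mem_image_of_mem g (Ioo_subset_Icc_self ht))) h0 ?_
  · have := abs_nonneg t
    constructor <;> linarith
  · have := neg_abs_le t
    have := le_abs_self t
    constructor <;> linarith

namespace IsCompleteFlowOf

variable {ψ : ℝ → F → F}

omit [FiniteDimensional ℝ F] in
theorem continuous_curve (hψ : IsCompleteFlowOf V ψ) (x : F) : Continuous fun t => ψ t x :=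
  continuous_iff_continuousAt.2 fun t => (hψ.2 x t).continuousAt

omit [FiniteDimensional ℝ F] in
/-- The time reversal of a complete flow of `V` is a complete flow of `-V`. -/
theorem reverse (hψ : IsCompleteFlowOf V ψ) : IsCompleteFlowOf (-V) fun t => ψ (-t) := by
  refine ⟨fun x => by simpa using hψ.1 x, fun x t => ?_⟩
  simpa [Function.comp_def] using (hψ.2 x (-t)).scomp t (hasDerivAt_neg t)

theorem flow_add (hV : LocallyLipschitz V) (hψ : IsCompleteFlowOf V ψ) (s t : ℝ) (x : F) :
    ψ (t + s) x = ψ t (ψ s x) := by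
  refine congrFun (hV.eq_of_hasDerivAt (f := fun t => ψ (t + s) x) (g := fun t => ψ t (ψ s x))
    (fun t => ?_) (hψ.2 _) ?_) t
  · exact (hψ.2 x (t + s)).comp_add_const t s
  · simp [hψ.1]

/-- Trajectories of nearby points stay within distance `1` of a given trajectory, over a compact
time interval. -/
theorem exists_forall_dist_lt_one (hV : LocallyLipschitz V) (hψ : IsCompleteFlowOf V ψ)
    (x : F) (T : ℝ) :
    ∃ δ > 0, ∀ y ∈ ball x δ, ∀ t ∈ Icc 0 T, dist (ψ t y) (ψ t x) < 1 := by
  have : ProperSpace F := FiniteDimensional.proper_real F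
  obtain ⟨K, hK⟩ := hV.exists_lipschitzOnWith_of_isBounded
    ((isCompact_Icc (a := 0) (b := T)).image (hψ.continuous_curve x)).isBounded.cthickening
  refine ⟨Real.exp (-(K * T)), Real.exp_pos _, fun y hy => ?_⟩
  by_contra! hne
  obtain ⟨τ, ⟨hτ, hτ1⟩, hmin⟩ := IsCompact.exists_isLeast
    (s := Icc 0 T ∩ {t | 1 ≤ dist (ψ t y) (ψ t x)})
    (isCompact_Icc.inter_right (isClosed_le continuous_const
      ((hψ.continuous_curve y).dist (hψ.continuous_curve x)))) hne
  have hlt : ∀ t ∈ Ico 0 τ, dist (ψ t y) (ψ t x) < 1 := fun t ht => by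
    by_contra! hc
    exact ht.2.not_ge (hmin ⟨⟨ht.1, ht.2.le.trans hτ.2⟩, hc⟩)
  have hmem : ∀ t ∈ Ico 0 τ, ψ t x ∈ (fun t => ψ t x) '' Icc 0 T := fun t ht =>
    mem_image_of_mem (fun t => ψ t x) ⟨ht.1, ht.2.le.trans hτ.2⟩
  have hgr := dist_le_of_trajectories_ODE_of_mem (v := fun _ => V) (K := K) (a := 0) (b := τ)
    (f := fun t => ψ t y) (g := fun t => ψ t x) (δ := dist y x)
    (s := fun _ => cthickening 1 ((fun t => ψ t x) '' Icc 0 T)) (fun _ _ => hK)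
    (hψ.continuous_curve y).continuousOn (fun t _ => (hψ.2 y t).hasDerivWithinAt)
    (fun t ht => mem_cthickening_of_dist_le _ _ _ _ (hmem t ht) (hlt t ht).le)
    (hψ.continuous_curve x).continuousOn (fun t _ => (hψ.2 x t).hasDerivWithinAt)
    (fun t ht => self_subset_cthickening _ (hmem t ht)) (by simp [hψ.1]) τ ⟨hτ.1, le_rfl⟩
  have : dist y x * Real.exp (K * (τ - 0)) < 1 := calc
    dist y x * Real.exp (K * (τ - 0)) < Real.exp (-(K * T)) * Real.exp (K * (τ - 0)) := by
      gcongr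
      exact hy
    _ ≤ Real.exp (-(K * T)) * Real.exp (K * T) := by
      gcongr
      linarith [hτ.2]
    _ = 1 := by rw [← Real.exp_add]; simp
  exact (hτ1.trans hgr).not_gt this

theorem locallyLipschitz_of_nonneg (hV : LocallyLipschitz V) (hψ : IsCompleteFlowOf V ψ)
    {T : ℝ} (hT : 0 ≤ T) : LocallyLipschitz (ψ T) := by
  have : ProperSpace F := FiniteDimensional.proper_real F
  intro x
  obtain ⟨K, hK⟩ := hV.exists_lipschitzOnWith_of_isBounded
    ((isCompact_Icc (a := 0) (b := T)).image (hψ.continuous_curve x)).isBounded.cthickening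
  obtain ⟨δ, hδ, hball⟩ := hψ.exists_forall_dist_lt_one hV x T
  have hmem : ∀ y ∈ ball x δ, ∀ t ∈ Ico 0 T,
      ψ t y ∈ cthickening 1 ((fun t => ψ t x) '' Icc 0 T) := fun y hy t ht =>
    mem_cthickening_of_dist_le _ _ _ _
      (mem_image_of_mem (fun t => ψ t x) (Ico_subset_Icc_self ht))
      (hball y hy t (Ico_subset_Icc_self ht)).le
  refine ⟨⟨Real.exp (K * T), (Real.exp_pos _).le⟩, ball x δ, ball_mem_nhds x hδ,
    LipschitzOnWith.of_dist_le_mul fun y hy z hz => ?_⟩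
  have := dist_le_of_trajectories_ODE_of_mem (v := fun _ => V) (K := K) (a := 0) (b := T)
    (f := fun t => ψ t y) (g := fun t => ψ t z) (δ := dist y z)
    (s := fun _ => cthickening 1 ((fun t => ψ t x) '' Icc 0 T)) (fun _ _ => hK)
    (hψ.continuous_curve y).continuousOn (fun t _ => (hψ.2 y t).hasDerivWithinAt) (hmem y hy)
    (hψ.continuous_curve z).continuousOn (fun t _ => (hψ.2 z t).hasDerivWithinAt) (hmem z hz)
    (by simp [hψ.1]) T ⟨hT, le_rfl⟩
  rw [sub_zero, mul_comm] at this
  exact this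

/-- The time-`t` map of the complete flow of a locally Lipschitz vector field is locally
Lipschitz. -/
theorem locallyLipschitz (hV : LocallyLipschitz V) (hψ : IsCompleteFlowOf V ψ) (t : ℝ) :
    LocallyLipschitz (ψ t) := by
  rcases le_total 0 t with ht | ht
  · exact hψ.locallyLipschitz_of_nonneg hV ht
  · have := hψ.reverse.locallyLipschitz_of_nonneg hV.neg (neg_nonneg.2 ht)
    simpa using this

omit [FiniteDimensional ℝ F] in
theorem locallyLipschitz_curve (hV : LocallyLipschitz V) (hψ : IsCompleteFlowOf V ψ) (x : F) :
    LocallyLipschitz fun t => ψ t x := by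
  refine ContDiff.locallyLipschitz (𝕂 := ℝ) (contDiff_one_iff_deriv.2
    ⟨fun t => (hψ.2 x t).differentiableAt, ?_⟩)
  rw [funext fun t => (hψ.2 x t).deriv]
  exact hV.continuous.comp (hψ.continuous_curve x)

end IsCompleteFlowOf

variable [MeasurableSpace F] [BorelSpace F] (μ : Measure F) [μ.IsAddHaarMeasure]

/-- A locally Lipschitz self-map of a finite-dimensional space sends null sets to null sets. -/
theorem LocallyLipschitz.addHaar_image_eq_zero {f : F → F} (hf : LocallyLipschitz f) {s : Set F}
    (hs : μ s = 0) : μ (f '' s) = 0 := by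
  have : ProperSpace F := FiniteDimensional.proper_real F
  set ν : Measure F := Measure.hausdorffMeasure (Module.finrank ℝ F)
  have hνs : ν s = 0 := Measure.absolutelyContinuous_isAddHaarMeasure ν μ hs
  refine Measure.absolutelyContinuous_isAddHaarMeasure μ ν ?_
  have hcover : f '' s = ⋃ n : ℕ, f '' (s ∩ closedBall 0 n) := by
    rw [← image_iUnion, ← inter_iUnion, iUnion_closedBall_nat, inter_univ]
  rw [hcover, measure_iUnion_null_iff]
  intro n
  obtain ⟨K, hK⟩ := hf.exists_lipschitzOnWith_of_isBounded
    ((isBounded_closedBall (x := (0 : F)) (r := n)).subset (inter_subset_right (s := s)))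
  have hle := hK.hausdorffMeasure_image_le (d := Module.finrank ℝ F) (Nat.cast_nonneg _)
  have h0 : ν (s ∩ closedBall 0 n) = 0 := measure_mono_null inter_subset_left hνs
  exact le_antisymm (hle.trans (by rw [h0, mul_zero])) bot_le

/-- **Rademacher's theorem** for locally Lipschitz functions. -/
theorem LocallyLipschitz.ae_differentiableAt {G : Type*} [NormedAddCommGroup G] [NormedSpace ℝ G]
    [FiniteDimensional ℝ G] {f : F → G} (hf : LocallyLipschitz f) :
    ∀ᵐ x ∂μ, DifferentiableAt ℝ f x := by
  have : ProperSpace F := FiniteDimensional.proper_real F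
  have hball : ∀ n : ℕ, ∀ᵐ x ∂μ, x ∈ ball (0 : F) n → DifferentiableWithinAt ℝ f (ball 0 n) x :=
    fun n => by
      obtain ⟨K, hK⟩ := hf.exists_lipschitzOnWith_of_isBounded
        (isBounded_ball (x := (0 : F)) (r := n))
      exact hK.ae_differentiableWithinAt_of_mem
  filter_upwards [ae_all_iff.2 hball] with x hx
  obtain ⟨n, hn⟩ := exists_nat_gt ‖x‖
  have hxn : x ∈ ball (0 : F) n := by simpa using hn
  exact (hx n hxn).differentiableAt (isOpen_ball.mem_nhds hxn)

/-- If a property holds almost everywhere, then almost every trajectory of the flow satisfies it at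
almost every time. -/
theorem IsCompleteFlowOf.ae_ae_of_ae {ψ : ℝ → F → F} (hV : LocallyLipschitz V)
    (hψ : IsCompleteFlowOf V ψ) {p : F → Prop} (hp : ∀ᵐ x ∂μ, p x) :
    ∀ᵐ x ∂μ, ∀ᵐ t : ℝ, p (ψ t x) := by
  set N := toMeasurable μ {x | ¬ p x}
  have hN : μ N = 0 := (measure_toMeasurable _).trans hp
  have hmeas : Measurable (Function.uncurry ψ) :=
    measurable_uncurry_of_continuous_of_measurable hψ.continuous_curve
      fun t => (hψ.locallyLipschitz hV t).continuous.measurable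
  have hpre : ∀ᵐ t : ℝ, ∀ᵐ x ∂μ, ψ t x ∉ N := ae_of_all _ fun t => by
    refine measure_mono_null (fun x hx => ?_)
      ((hψ.locallyLipschitz hV (-t)).addHaar_image_eq_zero μ hN)
    exact ⟨ψ t x, not_not.1 hx, by rw [← hψ.flow_add hV, neg_add_cancel, hψ.1]⟩
  have hmeasN : MeasurableSet {q : ℝ × F | ψ q.1 q.2 ∉ N} :=
    (hmeas (measurableSet_toMeasurable _ _)).compl
  filter_upwards [(Measure.ae_ae_comm hmeasN).1 hpre] with x hx
  filter_upwards [hx] with t ht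
  by_contra hc
  exact ht (subset_toMeasurable _ _ hc)

end Flow

theorem first_integral_iff_deriv_zero_ae (μ : Measure E) [μ.IsAddHaarMeasure]
    (V : E → E) (hV : LocallyLipschitz V) (ψ : ℝ → E → E)
    (hψ : IsCompleteFlowOf V ψ) (h : E → ℝ) (hh : LocallyLipschitz h) :
    (∀ (t : ℝ) (x : E), h (ψ t x) = h x) ↔
      ∀ᵐ x ∂μ, ∀ f : E →L[ℝ] ℝ, HasFDerivAt h f x → f (V x) = 0 := by
  constructor
  · intro hinv
    refine ae_of_all _ fun x f hf => ?_
    have hcurve := hψ.2 x 0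
    rw [hψ.1] at hcurve
    have hcomp : HasDerivAt (fun t => h (ψ t x)) (f (V x)) 0 :=
      HasFDerivAt.comp_hasDerivAt 0 (by rwa [hψ.1]) hcurve
    simp only [hinv] at hcomp
    exact hcomp.unique (hasDerivAt_const 0 (h x))
  · intro hzero t
    have hae : ∀ᵐ x ∂μ, h (ψ t x) = h x := by
      filter_upwards [hψ.ae_ae_of_ae μ hV (hzero.and (hh.ae_differentiableAt μ))] with x hx
      have hcomp := hh.comp (hψ.locallyLipschitz_curve hV x)
      obtain ⟨K, hK⟩ := hcomp.exists_lipschitzOnWith_of_isBounded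
        (isCompact_uIcc (a := 0) (b := t)).isBounded
      obtain ⟨C, hC⟩ := hK.absolutelyContinuousOnInterval.const_of_ae_hasDerivAt_zero (by
        filter_upwards [hx] with s hs _
        have hd := hs.2.hasFDerivAt.comp_hasDerivAt s (hψ.2 x s)
        rwa [hs.1 _ hs.2.hasFDerivAt] at hd)
      have := (hC t right_mem_uIcc).trans (hC 0 left_mem_uIcc).symm
      simpa [hψ.1] using this
    exact congrFun (Continuous.ext_on (Measure.dense_of_ae hae)
      (hh.continuous.comp (hψ.locallyLipschitz hV t).continuous) hh.continuous fun x hx => hx)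
end

section
/- There exists a smooth vector field V on the circle 𝕋 = ℝ/ℤ (with the standard quotient metric) whose flow ψ is chain recurrent (every point of 𝕋 is chain recurrent for ψ) and which admits a Lipschitz continuous Lyapunov function h : 𝕋 → ℝ that is not a first integral. -/
open MeasureTheory

/-- A chain recurrent point: for all `ε > 0`, `T ≥ 0` there is an `(ε,T)`-chain
from `x` to `x`, i.e. each jump `d(ψ_{t_i}(x_i), x_{i+1})` is `< ε`. -/
def ChainRecurrentPt {X : Type*} [MetricSpace X] (ψ : ℝ → X → X) (a : X) : Prop :=
  ∀ ε > 0, ∀ T ≥ (0 : ℝ), ∃ (n : ℕ) (x : Fin (n + 1) → X) (t : Fin n → ℝ),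
    0 < n ∧ (∀ i, T ≤ t i) ∧ x 0 = a ∧ x (Fin.last n) = a ∧
    ∀ i : Fin n, dist (ψ (t i) (x i.castSucc)) (x i.succ) < ε

/-- `ψ` is the flow on the circle `𝕋 = ℝ/ℤ` of the vector field `V(x) ∂/∂x`,
expressed via a lifted flow `Ψ` on `ℝ` solving the lifted ODE. -/
def IsCircleFlowOf (V : UnitAddCircle → ℝ) (ψ : ℝ → UnitAddCircle → UnitAddCircle) : Prop :=
  ∃ Ψ : ℝ → ℝ → ℝ, (∀ x : ℝ, Ψ 0 x = x) ∧
    (∀ x t : ℝ, HasDerivAt (fun s => Ψ s x) (V ((Ψ t x : ℝ) : UnitAddCircle)) t) ∧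
    ∀ t x : ℝ, ψ t ((x : ℝ) : UnitAddCircle) = ((Ψ t x : ℝ) : UnitAddCircle)

open Set

/-- `Ψ` is the global flow of the vector field `v` on the real line. -/
structure IsLineFlowOf (v : ℝ → ℝ) (Ψ : ℝ → ℝ → ℝ) : Prop where
  map_zero : ∀ x, Ψ 0 x = x
  hasDerivAt : ∀ x t, HasDerivAt (fun s => Ψ s x) (v (Ψ t x)) t

theorem exists_hasDerivAt_Ioo_of_lipschitzWith_of_bounded {v : ℝ → ℝ} {K C : NNReal}
    (hv : LipschitzWith K v) (hC : ∀ x, ‖v x‖ ≤ C) (x : ℝ) (n : ℕ) :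
    ∃ γ : ℝ → ℝ, γ 0 = x ∧ ∀ t ∈ Ioo (-(n : ℝ)) n, HasDerivAt γ (v (γ t)) t := by
  have h0 : (0 : ℝ) ∈ Icc (-(n : ℝ)) n := by simp
  have hpl : IsPicardLindelof (fun _ => v) ⟨0, h0⟩ x (C * n) 0 C K :=
    { lipschitzOnWith := fun _ _ => hv.lipschitzOnWith
      continuousOn := fun _ _ => continuousOn_const
      norm_le := fun _ _ y _ => hC y
      mul_max_le := by simp }
  obtain ⟨γ, hγ0, hγ⟩ := hpl.exists_eq_forall_mem_Icc_hasDerivWithinAt₀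
  exact ⟨γ, hγ0, fun t ht =>
    (hγ t (Ioo_subset_Icc_self ht)).hasDerivAt (Icc_mem_nhds ht.1 ht.2)⟩

theorem exists_hasDerivAt_of_lipschitzWith_of_bounded {v : ℝ → ℝ} {K C : NNReal}
    (hv : LipschitzWith K v) (hC : ∀ x, ‖v x‖ ≤ C) (x : ℝ) :
    ∃ γ : ℝ → ℝ, γ 0 = x ∧ ∀ t, HasDerivAt γ (v (γ t)) t := by
  choose γ hγ0 hγ using exists_hasDerivAt_Ioo_of_lipschitzWith_of_bounded hv hC x
  have heq : ∀ m n : ℕ, m ≤ n → ∀ t ∈ Ioo (-(m : ℝ)) m, γ m t = γ n t := by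
    intro m n hmn t ht
    have hmn' : (m : ℝ) ≤ n := by exact_mod_cast hmn
    have hm : (0 : ℝ) < m := by linarith [ht.1, ht.2]
    exact ODE_solution_unique_of_mem_Ioo (v := fun _ => v) (s := fun _ => univ) (t₀ := 0)
      (fun _ _ => hv.lipschitzOnWith) ⟨by linarith, hm⟩
      (fun s hs => ⟨hγ m s hs, trivial⟩)
      (fun s hs => ⟨hγ n s ⟨by linarith [hs.1], by linarith [hs.2]⟩, trivial⟩)
      (by rw [hγ0, hγ0]) ht
  have hmem : ∀ s : ℝ, s ∈ Ioo (-((⌊|s|⌋₊ + 1 : ℕ) : ℝ)) (⌊|s|⌋₊ + 1 : ℕ) := by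
    intro s
    push_cast
    exact abs_lt.1 (Nat.lt_floor_add_one _)
  have hglue : ∀ n : ℕ, ∀ s ∈ Ioo (-(n : ℝ)) n, γ (⌊|s|⌋₊ + 1) s = γ n s := by
    intro n s hs
    rcases le_total (⌊|s|⌋₊ + 1) n with h | h
    · exact heq _ _ h s (hmem s)
    · exact (heq _ _ h s hs).symm
  refine ⟨fun s => γ (⌊|s|⌋₊ + 1) s, hγ0 _, fun t => ?_⟩
  refine (hγ _ t (hmem t)).congr_of_eventuallyEq ?_
  filter_upwards [Ioo_mem_nhds (hmem t).1 (hmem t).2] with s hs using hglue _ s hs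

theorem exists_isLineFlowOf {v : ℝ → ℝ} {K C : NNReal}
    (hv : LipschitzWith K v) (hC : ∀ x, ‖v x‖ ≤ C) : ∃ Ψ, IsLineFlowOf v Ψ := by
  choose γ hγ0 hγ using exists_hasDerivAt_of_lipschitzWith_of_bounded hv hC
  exact ⟨fun t x => γ x t, hγ0, hγ⟩

namespace IsLineFlowOf

variable {v : ℝ → ℝ} {Ψ : ℝ → ℝ → ℝ} {K C : NNReal}

theorem eq_of_hasDerivAt (hΨ : IsLineFlowOf v Ψ) (hv : LipschitzWith K v) {γ : ℝ → ℝ}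
    (hγ : ∀ t, HasDerivAt γ (v (γ t)) t) (t : ℝ) : Ψ t (γ 0) = γ t :=
  congr_fun (ODE_solution_unique_univ (v := fun _ => v) (s := fun _ => univ) (t₀ := 0)
    (fun _ => hv.lipschitzOnWith) (fun s => ⟨hΨ.hasDerivAt (γ 0) s, trivial⟩)
    (fun s => ⟨hγ s, trivial⟩) (hΨ.map_zero _)) t

theorem map_add (hΨ : IsLineFlowOf v Ψ) (hv : LipschitzWith K v) (t s x : ℝ) :
    Ψ (t + s) x = Ψ t (Ψ s x) := by
  have h := hΨ.eq_of_hasDerivAt hv (γ := fun r => Ψ (r + s) x)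
    (fun r => (hΨ.hasDerivAt x (r + s)).comp_add_const r s) t
  simpa using h.symm

theorem map_of_eq_zero (hΨ : IsLineFlowOf v Ψ) (hv : LipschitzWith K v) {k : ℝ} (hk : v k = 0)
    (t : ℝ) : Ψ t k = k :=
  hΨ.eq_of_hasDerivAt hv (γ := fun _ => k) (fun r => by simpa [hk] using hasDerivAt_const r k) t

theorem periodic (hΨ : IsLineFlowOf v Ψ) (hv : LipschitzWith K v) (hp : Function.Periodic v 1)
    (t x : ℝ) : Ψ t (x + 1) = Ψ t x + 1 := by
  have h := hΨ.eq_of_hasDerivAt hv (γ := fun r => Ψ r x + 1)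
    (fun r => by simpa [hp (Ψ r x)] using (hΨ.hasDerivAt x r).add_const 1) t
  simpa [hΨ.map_zero] using h

theorem reverse (hΨ : IsLineFlowOf v Ψ) : IsLineFlowOf (fun x => -v x) (fun t => Ψ (-t)) where
  map_zero x := by simp [hΨ.map_zero]
  hasDerivAt x t := by
    simpa [Function.comp_def] using (hΨ.hasDerivAt x (-t)).scomp t (hasDerivAt_neg t)

theorem dist_le (hΨ : IsLineFlowOf v Ψ) (hv : LipschitzWith K v) {t : ℝ} (ht : 0 ≤ t)
    (x y : ℝ) : dist (Ψ t x) (Ψ t y) ≤ dist x y * Real.exp (K * t) := by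
  have h := dist_le_of_trajectories_ODE (v := fun _ => v) (a := 0) (b := t) (δ := dist x y)
    (fun _ => hv)
    (fun s _ => (hΨ.hasDerivAt x s).continuousAt.continuousWithinAt)
    (fun s _ => (hΨ.hasDerivAt x s).hasDerivWithinAt)
    (fun s _ => (hΨ.hasDerivAt y s).continuousAt.continuousWithinAt)
    (fun s _ => (hΨ.hasDerivAt y s).hasDerivWithinAt)
    (by simp [hΨ.map_zero]) t ⟨ht, le_rfl⟩
  simpa using h

theorem continuous_of_nonneg (hΨ : IsLineFlowOf v Ψ) (hv : LipschitzWith K v) {t : ℝ}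
    (ht : 0 ≤ t) : Continuous (Ψ t) :=
  (LipschitzWith.of_dist_le_mul (K := ⟨Real.exp (K * t), (Real.exp_pos _).le⟩) fun x y =>
    (hΨ.dist_le hv ht x y).trans_eq (mul_comm _ _)).continuous

theorem continuous_right (hΨ : IsLineFlowOf v Ψ) (hv : LipschitzWith K v) (t : ℝ) :
    Continuous (Ψ t) := by
  rcases le_total 0 t with ht | ht
  · exact hΨ.continuous_of_nonneg hv ht
  · simpa using hΨ.reverse.continuous_of_nonneg hv.neg (neg_nonneg.2 ht)

theorem continuous_left (hΨ : IsLineFlowOf v Ψ) (x : ℝ) : Continuous (fun t => Ψ t x) :=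
  continuous_iff_continuousAt.2 fun t => (hΨ.hasDerivAt x t).continuousAt

theorem continuous (hΨ : IsLineFlowOf v Ψ) (hv : LipschitzWith K v) (hC : ∀ x, ‖v x‖ ≤ C) :
    Continuous (fun p : ℝ × ℝ => Ψ p.1 p.2) := by
  have hL : ∀ x, LipschitzWith C (fun t => Ψ t x) := fun x =>
    lipschitzWith_of_nnnorm_deriv_le (fun t => (hΨ.hasDerivAt x t).differentiableAt)
      fun t => by rw [(hΨ.hasDerivAt x t).deriv]; exact hC _
  exact continuous_prod_of_continuous_lipschitzWith
    (fun p : ℝ × ℝ => Ψ p.1 p.2) C (fun t => hΨ.continuous_right hv t) hL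

theorem le_map (hΨ : IsLineFlowOf v Ψ) (hv0 : ∀ x, 0 ≤ v x) {t : ℝ} (ht : 0 ≤ t) (x : ℝ) :
    x ≤ Ψ t x := by
  have hm : Monotone (fun s => Ψ s x) :=
    monotone_of_deriv_nonneg (fun s => (hΨ.hasDerivAt x s).differentiableAt)
      fun s => by rw [(hΨ.hasDerivAt x s).deriv]; exact hv0 _
  simpa [hΨ.map_zero] using hm ht

/-- Trajectories do not cross the zeros of the vector field. -/
theorem map_le_of_eq_zero (hΨ : IsLineFlowOf v Ψ) (hv : LipschitzWith K v) {k : ℝ}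
    (hk : v k = 0) {t x : ℝ} (ht : 0 ≤ t) (hx : x ≤ k) : Ψ t x ≤ k := by
  by_contra! hlt
  obtain ⟨s, -, hs⟩ := intermediate_value_Icc ht (hΨ.continuous_left x).continuousOn
    (show k ∈ Icc (Ψ 0 x) (Ψ t x) from ⟨by rwa [hΨ.map_zero], hlt.le⟩)
  have hxk : x = k := by
    have h := hΨ.map_add hv (-s) s x
    rw [neg_add_cancel, hΨ.map_zero, show Ψ s x = k from hs, hΨ.map_of_eq_zero hv hk] at h
    exact h
  rw [hxk, hΨ.map_of_eq_zero hv hk] at hlt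
  exact lt_irrefl _ hlt

/-- If the vector field is nonnegative and vanishes at the integers, then a suitable number of
flow steps, each followed by a small forward jump of a suitable size `δ`, leads exactly
from `x` to `x + 1`. -/
theorem exists_iterate_eq_add_one (hΨ : IsLineFlowOf v Ψ) (hv : LipschitzWith K v)
    (hv0 : ∀ x, 0 ≤ v x) (hk : ∀ k : ℤ, v k = 0) {ε T : ℝ} (hε : 0 < ε) (hT : 0 ≤ T) (x : ℝ) :
    ∃ δ, 0 ≤ δ ∧ δ < ε ∧ ∃ n : ℕ, 0 < n ∧ (fun y => Ψ T y + δ)^[n] x = x + 1 := by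
  obtain ⟨n, hn⟩ := exists_nat_gt (1 / (ε / 2))
  have hn1 : 1 < n * (ε / 2) := (div_lt_iff₀ (by positivity)).1 hn
  have hn0 : 0 < n := by
    rcases Nat.eq_zero_or_pos n with rfl | h
    · norm_num at hn1
    · exact h
  have hcont : ∀ m : ℕ, Continuous (fun δ : ℝ => (fun y => Ψ T y + δ)^[m] x) := by
    intro m
    induction m with
    | zero => exact continuous_const
    | succ m ih =>
      simp only [Function.iterate_succ_apply']
      exact ((hΨ.continuous_right hv T).comp ih).add continuous_id
  have hlow : ∀ m : ℕ, (fun y => Ψ T y + 0)^[m] x ≤ ⌈x⌉ := by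
    intro m
    induction m with
    | zero => exact Int.le_ceil x
    | succ m ih =>
      rw [Function.iterate_succ_apply', add_zero]
      exact hΨ.map_le_of_eq_zero hv (hk _) hT ih
  have hhigh : ∀ m : ℕ, x + m * (ε / 2) ≤ (fun y => Ψ T y + ε / 2)^[m] x := by
    intro m
    induction m with
    | zero => simp
    | succ m ih =>
      rw [Function.iterate_succ_apply']
      have := hΨ.le_map hv0 hT ((fun y => Ψ T y + ε / 2)^[m] x)
      push_cast
      linarith
  obtain ⟨δ, hδ, h⟩ := intermediate_value_Icc (by positivity : (0 : ℝ) ≤ ε / 2)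
    (hcont n).continuousOn (show x + 1 ∈ Icc _ _ from
      ⟨(hlow n).trans (Int.ceil_lt_add_one x).le, by linarith [hhigh n]⟩)
  exact ⟨δ, hδ.1, by linarith [hδ.2], n, hn0, h⟩

end IsLineFlowOf

/-- The lift to the line of a nonnegative vector field on the circle vanishing on a half circle. -/
noncomputable def halfCircleField (x : ℝ) : ℝ := Real.smoothTransition (Real.sin (2 * Real.pi * x))

theorem halfCircleField_periodic : Function.Periodic halfCircleField 1 := fun x => by
  simp [halfCircleField, mul_add]

theorem contDiff_halfCircleField {n : ℕ∞} : ContDiff ℝ n halfCircleField :=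
  Real.smoothTransition.contDiff.comp (Real.contDiff_sin.comp (contDiff_const.mul contDiff_id))

theorem halfCircleField_nonneg (x : ℝ) : 0 ≤ halfCircleField x :=
  Real.smoothTransition.nonneg _

theorem norm_halfCircleField_le_one (x : ℝ) : ‖halfCircleField x‖ ≤ 1 := by
  rw [Real.norm_of_nonneg (halfCircleField_nonneg x)]
  exact Real.smoothTransition.le_one _

theorem halfCircleField_intCast (k : ℤ) : halfCircleField k = 0 := by
  have h : Real.sin (2 * Real.pi * k) = 0 := Real.sin_eq_zero_iff.2 ⟨2 * k, by push_cast; ring⟩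
  rw [halfCircleField, h, Real.smoothTransition.zero]

theorem sin_mul_halfCircleField_nonneg (x : ℝ) :
    0 ≤ Real.sin (2 * Real.pi * x) * halfCircleField x := by
  rcases le_total (Real.sin (2 * Real.pi * x)) 0 with h | h
  · rw [halfCircleField, Real.smoothTransition.zero_of_nonpos h, mul_zero]
  · exact mul_nonneg h (halfCircleField_nonneg x)

theorem exists_lipschitzWith_of_contDiff_of_periodic {f : ℝ → ℝ} (hf : ContDiff ℝ 1 f)
    (hp : Function.Periodic f 1) : ∃ K, LipschitzWith K f := by
  have hp' : Function.Periodic (deriv f) 1 := fun x => by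
    rw [← deriv_comp_add_const, hp.funext]
  obtain ⟨C, hC⟩ := (hp'.isBounded_of_continuous one_ne_zero
    (hf.continuous_deriv le_rfl)).exists_norm_le
  exact ⟨C.toNNReal, lipschitzWith_of_nnnorm_deriv_le (hf.differentiable one_ne_zero) fun x =>
    NNReal.le_toNNReal_of_coe_le (hC _ (mem_range_self x))⟩

theorem cos_two_pi_mul_periodic : Function.Periodic (fun x : ℝ => Real.cos (2 * Real.pi * x)) 1 :=
  fun x => by simp [mul_add]

theorem UnitAddCircle.dist_coe_le (x y : ℝ) :
    dist (x : UnitAddCircle) (y : UnitAddCircle) ≤ |x - y| := by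
  rw [dist_eq_norm, ← AddCircle.coe_sub, UnitAddCircle.norm_eq]
  simpa using round_le (x - y) 0

theorem UnitAddCircle.lipschitzWith_lift {f : ℝ → ℝ} {K : NNReal} (hf : LipschitzWith K f)
    (hp : Function.Periodic f 1) : LipschitzWith K (hp.lift : UnitAddCircle → ℝ) := by
  refine LipschitzWith.of_dist_le_mul fun p q => ?_
  induction p using QuotientAddGroup.induction_on with | H x => ?_
  induction q using QuotientAddGroup.induction_on with | H y => ?_
  have h := hf.dist_le_mul x (y + round (x - y))
  have hy : f (y + round (x - y)) = f y := by simpa using hp.int_mul (round (x - y)) y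
  rw [hy, Real.dist_eq x, ← sub_sub] at h
  rw [dist_eq_norm (x : UnitAddCircle), ← AddCircle.coe_sub, UnitAddCircle.norm_eq]
  exact h

theorem hasDerivAt_cos_two_pi_mul_flow {v : ℝ → ℝ} {Ψ : ℝ → ℝ → ℝ} (hΨ : IsLineFlowOf v Ψ)
    (x t : ℝ) : HasDerivAt (fun s => Real.cos (2 * Real.pi * Ψ s x))
      (-Real.sin (2 * Real.pi * Ψ t x) * (2 * Real.pi * v (Ψ t x))) t :=
  ((hΨ.hasDerivAt x t).const_mul (2 * Real.pi)).cos

theorem exists_CR_flow_with_nontrivial_lipschitz_lyapunov :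
    ∃ (V : UnitAddCircle → ℝ) (ψ : ℝ → UnitAddCircle → UnitAddCircle),
      ContDiff ℝ (⊤ : ℕ∞) (fun x : ℝ => V x) ∧ IsFlow ψ ∧ IsCircleFlowOf V ψ ∧
      (∀ p : UnitAddCircle, ChainRecurrentPt ψ p) ∧
      ∃ h : UnitAddCircle → ℝ, (∃ K : NNReal, LipschitzWith K h) ∧
        IsLyapunov ψ h ∧ ¬ IsFirstIntegral ψ h := by
  obtain ⟨K, hv⟩ := exists_lipschitzWith_of_contDiff_of_periodic
    (contDiff_halfCircleField (n := 1)) halfCircleField_periodic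
  have hC : ∀ x, ‖halfCircleField x‖ ≤ (1 : NNReal) := norm_halfCircleField_le_one
  obtain ⟨Ψ, hΨ⟩ := exists_isLineFlowOf hv hC
  have hper : ∀ t, Function.Periodic (fun x => (Ψ t x : UnitAddCircle)) 1 := fun t x => by
    simp [hΨ.periodic hv halfCircleField_periodic]
  obtain ⟨L, hL⟩ := exists_lipschitzWith_of_contDiff_of_periodic
    (Real.contDiff_cos.comp (contDiff_const.mul contDiff_id)) cos_two_pi_mul_periodic
  refine ⟨halfCircleField_periodic.lift, fun t => (hper t).lift, contDiff_halfCircleField,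
    ⟨?_, ?_, ?_⟩, ⟨Ψ, hΨ.map_zero, hΨ.hasDerivAt, fun _ _ => rfl⟩, ?_, cos_two_pi_mul_periodic.lift,
    ⟨L, UnitAddCircle.lipschitzWith_lift hL _⟩, ?_, ?_⟩
  · have hq : IsOpenQuotientMap (Prod.map id ((↑) : ℝ → UnitAddCircle) : ℝ × ℝ → _) :=
      IsOpenQuotientMap.id.prodMap QuotientAddGroup.isOpenQuotientMap_mk
    rw [← hq.continuous_comp_iff]
    exact (AddCircle.continuous_mk' 1).comp (hΨ.continuous hv hC)
  · intro p
    induction p using QuotientAddGroup.induction_on with | H x => ?_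
    exact congr_arg _ (hΨ.map_zero x)
  · intro t s p
    induction p using QuotientAddGroup.induction_on with | H x => ?_
    exact congr_arg _ (hΨ.map_add hv t s x)
  · intro p ε hε T hT
    induction p using QuotientAddGroup.induction_on with | H x => ?_
    obtain ⟨δ, hδ0, hδε, n, hn, h⟩ := hΨ.exists_iterate_eq_add_one hv halfCircleField_nonneg
      halfCircleField_intCast hε hT x
    refine ⟨n, fun i => (((fun y => Ψ T y + δ)^[i] x : ℝ) : UnitAddCircle), fun _ => T, hn,
      fun _ => le_rfl, rfl, ?_, fun i => ?_⟩
    · simp [h]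
    · refine (UnitAddCircle.dist_coe_le _ _).trans_lt ?_
      simp only [Fin.val_succ, Fin.val_castSucc, Function.iterate_succ_apply']
      simpa [abs_of_nonneg hδ0] using hδε
  · intro t ht p
    induction p using QuotientAddGroup.induction_on with | H x => ?_
    have hanti : Antitone (fun s => Real.cos (2 * Real.pi * Ψ s x)) := by
      refine antitone_of_deriv_nonpos
        (fun s => (hasDerivAt_cos_two_pi_mul_flow hΨ x s).differentiableAt) fun s => ?_
      rw [(hasDerivAt_cos_two_pi_mul_flow hΨ x s).deriv]
      nlinarith [mul_nonneg Real.pi_pos.le (sin_mul_halfCircleField_nonneg (Ψ s x))]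
    have h := hanti ht
    simp only [hΨ.map_zero] at h
    exact h
  · intro hfi
    have hconst : (fun s => Real.cos (2 * Real.pi * Ψ s (1 / 4))) =
        fun _ => Real.cos (2 * Real.pi * (1 / 4)) :=
      funext fun s => hfi s ((1 / 4 : ℝ) : UnitAddCircle)
    have hd := hasDerivAt_cos_two_pi_mul_flow hΨ (1 / 4) 0
    rw [hconst] at hd
    have h0 := hd.unique (hasDerivAt_const _ _)
    have hs : Real.sin (2 * Real.pi * (1 / 4)) = 1 := by
      rw [show 2 * Real.pi * (1 / 4) = Real.pi / 2 by ring, Real.sin_pi_div_two]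
    rw [hΨ.map_zero, halfCircleField, hs, Real.smoothTransition.one] at h0
    linarith [Real.pi_pos]
end
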